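/- For every (x, p, μ) ∈ 𝕋^d × ℝ^d × P(𝕋^d) there exists a real number H̄(x,p,μ) with the following property: for every ε > 0 there is δ₀ > 0 such that for all δ ∈ (0, δ₀) and every classical (C²) solution v^δ of the discounted cell problem δv(y) − tr(a D²v(y)) + H(x, y, p, Dv(y), μ) = 0 on 𝕋^d, one has sup_{y∈𝕋^d} |δ v^δ(y) + H̄(x,p,μ)| ≤ ε. -/

import Mathlib

noncomputable section

open MeasureTheory Metric Filter
open scoped RealInnerProductSpace ENNReal Topology

instance : Fact ((0:ℝ) < 1) := ⟨one_pos⟩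

/-- Euclidean space `ℝ^d`. -/
abbrev Euc (d : ℕ) := EuclideanSpace ℝ (Fin d)

/-- The flat torus `𝕋^d = ℝ^d/ℤ^d`, realized as a product of circles. -/
abbrev Torus (d : ℕ) := Fin d → AddCircle (1 : ℝ)

/-- Canonical projection `ℝ^d → 𝕋^d`. -/
def Torus.proj {d : ℕ} (y : Euc d) : Torus d := fun i => (y i : AddCircle (1 : ℝ))

/-- The 1-Wasserstein distance between two (probability) measures on a metric
measurable space: the infimum over all couplings of the expected distance. -/
def W1 {X : Type*} [MeasurableSpace X] [PseudoMetricSpace X] (μ ν : Measure X) : ℝ :=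
  ⨅ π : {π : Measure (X × X) //
      IsProbabilityMeasure π ∧ π.map Prod.fst = μ ∧ π.map Prod.snd = ν},
    ∫ z, dist z.1 z.2 ∂(π : Measure (X × X))

/-- `P(𝕋^d)`: Borel probability measures on the torus. -/
abbrev ProbT (d : ℕ) := ProbabilityMeasure (Torus d)

/-- 1-Wasserstein distance on `P(𝕋^d)`. -/
def W1T {d : ℕ} (μ ν : ProbT d) : ℝ := W1 (μ : Measure (Torus d)) (ν : Measure (Torus d))

/-- Second partial derivative `∂²v/∂yᵢ∂yⱼ`. -/
def hess {d : ℕ} (v : Euc d → ℝ) (y : Euc d) (i j : Fin d) : ℝ :=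
  iteratedFDeriv ℝ 2 v y ![EuclideanSpace.single i 1, EuclideanSpace.single j 1]

/-- `tr(a D²v)(y)` for a constant matrix `a`. -/
def trAH {d : ℕ} (a : Matrix (Fin d) (Fin d) ℝ) (v : Euc d → ℝ) (y : Euc d) : ℝ :=
  ∑ i, ∑ j, a i j * hess v y j i

/-- The `ℤ^d`-periodic lift of a function on the torus. -/
def tlift {d : ℕ} (v : Torus d → ℝ) : Euc d → ℝ := fun y => v (Torus.proj y)

/-- `v : 𝕋^d → ℝ` is a classical (C²) solution of the discounted cell problem
`δ v(y) - tr(a D²v(y)) + H(x, y, p, Dv(y), μ) = 0` on `𝕋^d`. -/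
def IsSol {d : ℕ} (a : Matrix (Fin d) (Fin d) ℝ)
    (H : Torus d → Torus d → Euc d → Euc d → ProbT d → ℝ)
    (δ : ℝ) (x : Torus d) (p : Euc d) (μ : ProbT d) (v : Torus d → ℝ) : Prop :=
  ContDiff ℝ 2 (tlift v) ∧
  ∀ y : Euc d,
    δ * v (Torus.proj y) - trAH a (tlift v) y
      + H x (Torus.proj y) p (gradient (tlift v) y) μ = 0

/-- The second derivative test: at a local maximum the second derivative is nonpositive. -/
theorem deriv_deriv_nonpos_of_isLocalMax {g : ℝ → ℝ} {t : ℝ} (hg : ContinuousAt g t)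
    (h : IsLocalMax g t) : deriv (deriv g) t ≤ 0 := by
  by_contra! hpos
  have hmin : IsLocalMin g t := isLocalMin_of_deriv_deriv_pos hpos h.deriv_eq_zero hg
  have hc : g =ᶠ[𝓝 t] fun _ => g t := by
    filter_upwards [h, hmin] with s h1 h2 using le_antisymm h1 h2
  have h2 : deriv (deriv g) t = 0 := by
    rw [hc.deriv.deriv_eq]
    simp
  exact hpos.ne' h2

section SecondOrder

variable {E : Type*} [NormedAddCommGroup E] [NormedSpace ℝ E]

theorem hasDerivAt_comp_line {u : E → ℝ} (hu : ContDiff ℝ 2 u) (x ξ : E) (t : ℝ) :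
    HasDerivAt (fun t : ℝ => u (x + t • ξ)) (fderiv ℝ u (x + t • ξ) ξ) t := by
  have hl : HasDerivAt (fun t : ℝ => x + t • ξ) ξ t := by
    simpa using ((hasDerivAt_id t).smul_const ξ).const_add x
  exact ((hu.differentiable (by norm_num)) _).hasFDerivAt.comp_hasDerivAt t hl

theorem hasDerivAt_fderiv_comp_line {u : E → ℝ} (hu : ContDiff ℝ 2 u) (x ξ : E) :
    HasDerivAt (fun t : ℝ => fderiv ℝ u (x + t • ξ) ξ) (fderiv ℝ (fderiv ℝ u) x ξ ξ) 0 := by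
  have hl : HasDerivAt (fun t : ℝ => x + t • ξ) ξ 0 := by
    simpa using ((hasDerivAt_id (0 : ℝ)).smul_const ξ).const_add x
  have h1 : ContDiff ℝ 1 (fderiv ℝ u) := hu.fderiv_right (by norm_num)
  have h2 : HasFDerivAt (fderiv ℝ u) (fderiv ℝ (fderiv ℝ u) x) (x + (0 : ℝ) • ξ) := by
    simpa using ((h1.differentiable (by norm_num)) x).hasFDerivAt
  have h3 := h2.comp_hasDerivAt (0 : ℝ) hl
  simpa using h3.clm_apply (hasDerivAt_const (0 : ℝ) ξ)

/-- Second order condition for a maximum of `u - w - ψ` along a pair of lines. -/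
theorem second_order_le_of_isLocalMax {u w : E → ℝ} (hu : ContDiff ℝ 2 u) (hw : ContDiff ℝ 2 w)
    {ψ ψ' : ℝ → ℝ} {c : ℝ} (hψ : ∀ t, HasDerivAt ψ (ψ' t) t) (hψ' : HasDerivAt ψ' c 0)
    (x y ξ η : E)
    (h : IsLocalMax (fun t : ℝ => u (x + t • ξ) - w (y + t • η) - ψ t) 0) :
    fderiv ℝ (fderiv ℝ u) x ξ ξ - fderiv ℝ (fderiv ℝ w) y η η ≤ c := by
  have h1 : ∀ t, HasDerivAt (fun t : ℝ => u (x + t • ξ) - w (y + t • η) - ψ t)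
      (fderiv ℝ u (x + t • ξ) ξ - fderiv ℝ w (y + t • η) η - ψ' t) t := fun t =>
    ((hasDerivAt_comp_line hu x ξ t).sub (hasDerivAt_comp_line hw y η t)).sub (hψ t)
  have h2 := deriv_deriv_nonpos_of_isLocalMax (h1 0).continuousAt h
  rw [show deriv (fun t : ℝ => u (x + t • ξ) - w (y + t • η) - ψ t) = _ from
    funext fun t => (h1 t).deriv] at h2
  have h3 := (((hasDerivAt_fderiv_comp_line hu x ξ).sub
    (hasDerivAt_fderiv_comp_line hw y η)).sub hψ').deriv
  have h4 : fderiv ℝ (fderiv ℝ u) x ξ ξ - fderiv ℝ (fderiv ℝ w) y η η - c ≤ 0 := by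
    rw [← h3]
    exact h2
  linarith

end SecondOrder

/-- Trace of the product of a positive semidefinite matrix with a nonpositive form. -/
theorem sum_mul_nonpos_of_posSemidef {d : ℕ} {S : Matrix (Fin d) (Fin d) ℝ} (hS : S.PosSemidef)
    (Q : Euc d →L[ℝ] Euc d →L[ℝ] ℝ) (hQ : ∀ ξ, Q ξ ξ ≤ 0) :
    ∑ i, ∑ j, S i j * Q (EuclideanSpace.single j 1) (EuclideanSpace.single i 1) ≤ 0 := by
  obtain ⟨m, B, hB⟩ := Matrix.posSemidef_iff_eq_sum_vecMulVec.mp hS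
  have h : ∑ i, ∑ j, S i j * Q (EuclideanSpace.single j 1) (EuclideanSpace.single i 1)
      = ∑ k, Q (∑ j, B k j • EuclideanSpace.single j 1)
          (∑ i, B k i • EuclideanSpace.single i 1) := by
    simp only [map_sum, sum_apply, map_smul, smul_apply, smul_eq_mul, hB, Matrix.sum_apply,
      Matrix.vecMulVec_apply, star_trivial, Finset.sum_mul, Finset.mul_sum]
    rw [Finset.sum_congr rfl fun i _ => Finset.sum_comm, Finset.sum_comm]
    refine Finset.sum_congr rfl fun k _ => Finset.sum_congr rfl fun i _ =>
      Finset.sum_congr rfl fun j _ => ?_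
    ring
  rw [h]
  exact Finset.sum_nonpos fun k _ => hQ _

theorem trAH_eq {d : ℕ} (a : Matrix (Fin d) (Fin d) ℝ) (v : Euc d → ℝ) (y : Euc d) :
    trAH a v y = ∑ i, ∑ j, a i j *
      fderiv ℝ (fderiv ℝ v) y (EuclideanSpace.single j 1) (EuclideanSpace.single i 1) := by
  simp [trAH, hess, iteratedFDeriv_two_apply]

/-- Uniform ellipticity: a positive definite matrix dominates a fixed multiple of every
projection onto a line. -/
theorem exists_posSemidef_sub_smul {d : ℕ} {a : Matrix (Fin d) (Fin d) ℝ} (ha : a.PosDef) :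
    ∃ θ : ℝ, 0 < θ ∧ ∀ e : Euc d, ‖e‖ = 1 →
      (a - θ • Matrix.of fun i j => e i * e j).PosSemidef := by
  have hcont : Continuous fun ξ : Euc d => ∑ i, ∑ j, ξ i * a i j * ξ j := by fun_prop
  have hq : ∀ ξ : Euc d, ξ ≠ 0 → 0 < ∑ i, ∑ j, ξ i * a i j * ξ j := by
    intro ξ hξ
    have h := ha.dotProduct_mulVec_pos (x := ξ.ofLp) (by simpa using hξ)
    simpa [dotProduct, Matrix.mulVec, Finset.mul_sum, mul_assoc] using h
  obtain ⟨θ, hθ, hle⟩ : ∃ θ : ℝ, 0 < θ ∧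
      ∀ ξ : Euc d, ‖ξ‖ = 1 → θ ≤ ∑ i, ∑ j, ξ i * a i j * ξ j := by
    rcases (sphere (0 : Euc d) 1).eq_empty_or_nonempty with hs | hs
    · refine ⟨1, one_pos, fun ξ hξ => ?_⟩
      have : ξ ∈ sphere (0 : Euc d) 1 := by simpa using hξ
      simp [hs] at this
    · obtain ⟨ξ₀, h0, hmin⟩ := (isCompact_sphere (0 : Euc d) 1).exists_isMinOn hs hcont.continuousOn
      refine ⟨_, hq ξ₀ ?_, fun ξ hξ => hmin (by simpa using hξ)⟩
      rintro rfl
      simp at h0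
  have hall : ∀ ξ : Euc d, θ * ‖ξ‖ ^ 2 ≤ ∑ i, ∑ j, ξ i * a i j * ξ j := by
    intro ξ
    rcases eq_or_ne ξ 0 with rfl | hξ
    · simp
    have hn : 0 < ‖ξ‖ := norm_pos_iff.mpr hξ
    have h := hle (‖ξ‖⁻¹ • ξ) (by simp [norm_smul, hn.ne'])
    have h2 : ∑ i, ∑ j, (‖ξ‖⁻¹ • ξ) i * a i j * (‖ξ‖⁻¹ • ξ) j
        = (‖ξ‖ ^ 2)⁻¹ * ∑ i, ∑ j, ξ i * a i j * ξ j := by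
      simp only [Finset.mul_sum, PiLp.smul_apply, smul_eq_mul]
      refine Finset.sum_congr rfl fun i _ => Finset.sum_congr rfl fun j _ => ?_
      field_simp
    rw [h2, inv_mul_eq_div, le_div_iff₀ (by positivity)] at h
    exact h
  refine ⟨θ, hθ, fun e he => Matrix.PosSemidef.of_dotProduct_mulVec_nonneg ?_ fun x => ?_⟩
  · refine ha.1.sub ?_
    ext i j
    simp [mul_comm]
  · have h := hall (WithLp.toLp 2 x)
    have hcs : (∑ i, e i * x i) ^ 2 ≤ ‖(WithLp.toLp 2 x : Euc d)‖ ^ 2 := by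
      have h1 := abs_real_inner_le_norm e (WithLp.toLp 2 x : Euc d)
      rw [he, one_mul] at h1
      have h2 : inner ℝ e (WithLp.toLp 2 x : Euc d) = ∑ i, e i * x i := by
        simp [PiLp.inner_apply, mul_comm]
      rw [← h2, ← sq_abs]
      gcongr
    have key : star x ⬝ᵥ (a - θ • Matrix.of fun i j => e i * e j).mulVec x
        = (∑ i, ∑ j, x i * a i j * x j) - θ * (∑ i, e i * x i) ^ 2 := by
      rw [sq, Finset.sum_mul_sum, Finset.mul_sum, ← Finset.sum_sub_distrib]
      simp only [dotProduct, Matrix.mulVec, star_trivial, Finset.mul_sum]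
      refine Finset.sum_congr rfl fun i _ => ?_
      rw [← Finset.sum_sub_distrib]
      refine Finset.sum_congr rfl fun j _ => ?_
      simp
      ring
    rw [key]
    have h3 := mul_le_mul_of_nonneg_left hcs hθ.le
    simp only at h
    linarith

section Periodic

variable {d : ℕ}

theorem Torus.proj_add (x y : Euc d) : Torus.proj (x + y) = Torus.proj x + Torus.proj y := by
  ext i
  simp [Torus.proj]

theorem Torus.proj_surjective : Function.Surjective (Torus.proj (d := d)) := by
  intro t
  choose y hy using fun i => QuotientAddGroup.mk_surjective (t i)
  exact ⟨WithLp.toLp 2 y, funext hy⟩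

/-- Every point has a shortest representative modulo `ℤ^d`, in a fixed ball. -/
theorem Torus.exists_proj_eq_norm_le (z : Euc d) :
    ∃ z' : Euc d, Torus.proj z' = Torus.proj z ∧ ‖z'‖ ≤ ‖z‖ ∧ ‖z'‖ ≤ √d := by
  refine ⟨WithLp.toLp 2 fun i => z i - round (z i), ?_, ?_, ?_⟩
  · ext i
    simp only [Torus.proj, AddCircle.coe_sub, sub_eq_self]
    exact (AddCircle.coe_eq_zero_iff 1).mpr ⟨round (z i), by simp⟩
  · rw [EuclideanSpace.norm_eq, EuclideanSpace.norm_eq]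
    gcongr with i
    simpa using round_le (z i) 0
  · rw [EuclideanSpace.norm_eq]
    gcongr
    calc ∑ i, ‖z i - round (z i)‖ ^ 2 ≤ ∑ i : Fin d, (1 : ℝ) := by
          refine Finset.sum_le_sum fun i _ => ?_
          have := abs_sub_round (z i)
          rw [Real.norm_eq_abs]
          nlinarith [abs_nonneg (z i - round (z i))]
      _ = d := by simp

theorem tlift_eq_of_proj_eq (v : Torus d → ℝ) {y z : Euc d} (h : Torus.proj y = Torus.proj z) :
    tlift v y = tlift v z := by
  simp only [tlift, h]

/-- Maximum principle: at a maximum point of `u - w`, gradients agree and the second order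
parts are ordered. -/
theorem exists_touching_point {a : Matrix (Fin d) (Fin d) ℝ} (ha : a.PosSemidef)
    {u w : Torus d → ℝ} (hu : ContDiff ℝ 2 (tlift u)) (hw : ContDiff ℝ 2 (tlift w)) :
    ∃ y : Euc d, (∀ z, tlift u z - tlift w z ≤ tlift u y - tlift w y) ∧
      gradient (tlift u) y = gradient (tlift w) y ∧ trAH a (tlift u) y ≤ trAH a (tlift w) y := by
  obtain ⟨y, -, hy⟩ := (isCompact_closedBall (0 : Euc d) √d).exists_isMaxOn
    ⟨0, by simp⟩ (hu.continuous.sub hw.continuous).continuousOn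
  have hmax : ∀ z, tlift u z - tlift w z ≤ tlift u y - tlift w y := by
    intro z
    obtain ⟨z', hz, -, hn⟩ := Torus.exists_proj_eq_norm_le z
    rw [← tlift_eq_of_proj_eq u hz, ← tlift_eq_of_proj_eq w hz]
    exact hy (by simpa using hn)
  refine ⟨y, hmax, ?_, ?_⟩
  · have h1 : IsLocalMax (fun z => tlift u z - tlift w z) y := Eventually.of_forall hmax
    have h2 := h1.fderiv_eq_zero
    rw [fderiv_fun_sub (hu.differentiable (by norm_num) y) (hw.differentiable (by norm_num) y),
      sub_eq_zero] at h2
    simp [gradient, h2]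
  · have h := sum_mul_nonpos_of_posSemidef ha
      (fderiv ℝ (fderiv ℝ (tlift u)) y - fderiv ℝ (fderiv ℝ (tlift w)) y) fun ξ => by
        refine second_order_le_of_isLocalMax hu hw (ψ := fun _ => 0) (ψ' := fun _ => 0)
          (fun t => hasDerivAt_const _ _) (hasDerivAt_const _ _) y y ξ ξ ?_
        refine Eventually.of_forall fun t => ?_
        simpa using hmax (y + t • ξ)
    simp only [sub_apply, mul_sub, Finset.sum_sub_distrib] at h
    rw [trAH_eq, trAH_eq]
    linarith

theorem norm_gradient (u : Euc d → ℝ) (y : Euc d) : ‖gradient u y‖ = ‖fderiv ℝ u y‖ := by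
  simp [gradient]

theorem norm_fderiv_le_of_directional {u : Euc d → ℝ} (hu : ContDiff ℝ 2 u) {x : Euc d} {c : ℝ}
    (hc : 0 ≤ c) (h : ∀ ξ, ∀ t : ℝ, 0 < t → u (x + t • ξ) - u x ≤ c * (t * ‖ξ‖)) :
    ‖fderiv ℝ u x‖ ≤ c := by
  have key : ∀ ξ, fderiv ℝ u x ξ ≤ c * ‖ξ‖ := by
    intro ξ
    have h1 := (hasDerivAt_comp_line hu x ξ 0).tendsto_slope_zero_right
    simp only [zero_smul, add_zero, zero_add, smul_eq_mul] at h1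
    refine le_of_tendsto h1 ?_
    filter_upwards [self_mem_nhdsWithin] with t ht
    have ht : 0 < t := ht
    rw [inv_mul_le_iff₀ ht]
    have := h ξ t ht
    linarith
  refine ContinuousLinearMap.opNorm_le_bound _ hc fun ξ => ?_
  rw [Real.norm_eq_abs, abs_le]
  have h1 := key ξ
  have h2 := key (-ξ)
  rw [map_neg, norm_neg] at h2
  exact ⟨by linarith, h1⟩

/-- Oscillation estimate by doubling of variables: periodic functions whose second order part
is controlled by an affine function of the gradient have bounded oscillation. -/
theorem exists_oscillation_bound {a : Matrix (Fin d) (Fin d) ℝ} (ha : a.PosDef) {K M : ℝ}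
    (hK : 0 ≤ K) (hM : 0 ≤ M) :
    ∃ C : ℝ, ∀ v : Torus d → ℝ, ContDiff ℝ 2 (tlift v) →
      (∀ y, |trAH a (tlift v) y| ≤ K + M * ‖gradient (tlift v) y‖) →
      ∀ s t, v s - v t ≤ C := by
  obtain ⟨θ, hθ, hps⟩ := exists_posSemidef_sub_smul ha
  set l : ℝ := (M + 1) / θ with hl
  have hlpos : 0 < l := by positivity
  set B : ℝ := (K + 1) * Real.exp (l * √d) with hB
  have hBpos : 0 < B := by positivity
  set φ : ℝ → ℝ := fun r => B / l * (1 - Real.exp (-(l * r))) with hφ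
  have hφ1 : ∀ r, HasDerivAt φ (B * Real.exp (-(l * r))) r := by
    intro r
    have h := (((((hasDerivAt_id r).const_mul l).neg).exp).const_sub 1).const_mul (B / l)
    refine h.congr_deriv ?_
    simp only [id, Pi.neg_apply]
    field_simp
  have hφ2 : ∀ r, HasDerivAt (fun r => B * Real.exp (-(l * r)))
      (-(l * (B * Real.exp (-(l * r))))) r := by
    intro r
    have h := ((((hasDerivAt_id r).const_mul l).neg).exp).const_mul B
    refine h.congr_deriv ?_
    simp only [id, Pi.neg_apply]
    ring
  have hmono : Monotone φ := by
    intro r s hrs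
    simp only [hφ]
    gcongr
  have htan : ∀ r s, φ (r + s) - φ r ≤ B * Real.exp (-(l * r)) * s := by
    intro r s
    have h1 := Real.add_one_le_exp (-(l * s))
    have h2 : φ (r + s) - φ r = B / l * Real.exp (-(l * r)) * (1 - Real.exp (-(l * s))) := by
      simp only [hφ, mul_add, neg_add, Real.exp_add]
      ring
    rw [h2]
    calc B / l * Real.exp (-(l * r)) * (1 - Real.exp (-(l * s)))
        ≤ B / l * Real.exp (-(l * r)) * (l * s) := by gcongr; linarith
      _ = B * Real.exp (-(l * r)) * s := by field_simp
  refine ⟨B / l, fun v hv hbd s t => ?_⟩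
  set u := tlift v with hu
  have hφcont : Continuous φ := continuous_iff_continuousAt.mpr fun r => (hφ1 r).continuousAt
  have hcont : Continuous fun q : Euc d × Euc d => u (q.1 + q.2) - u q.1 - φ ‖q.2‖ :=
    ((hv.continuous.comp (continuous_fst.add continuous_snd)).sub
      (hv.continuous.comp continuous_fst)).sub (hφcont.comp continuous_snd.norm)
  obtain ⟨⟨y, z⟩, hmem, hmax⟩ := ((isCompact_closedBall (0 : Euc d) √d).prod
    (isCompact_closedBall (0 : Euc d) √d)).exists_isMaxOn ⟨0, by simp⟩ hcont.continuousOn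
  have hz : ‖z‖ ≤ √d := by simpa using hmem.2
  have hglob : ∀ x' y', u x' - u y' - φ ‖x' - y'‖ ≤ u (y + z) - u y - φ ‖z‖ := by
    intro x' y'
    obtain ⟨y₁, hy1, -, hy2⟩ := Torus.exists_proj_eq_norm_le y'
    obtain ⟨z₁, hz1, hz2, hz3⟩ := Torus.exists_proj_eq_norm_le (x' - y')
    have h1 := hmax (a := (y₁, z₁)) ⟨by simpa using hy2, by simpa using hz3⟩
    have h2 : u (y₁ + z₁) = u x' := tlift_eq_of_proj_eq v (by
      rw [Torus.proj_add, hy1, hz1, ← Torus.proj_add, add_sub_cancel])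
    have h3 : u y₁ = u y' := tlift_eq_of_proj_eq v hy1
    have h4 := hmono hz2
    simp only [Set.mem_ofPred_eq, h2, h3] at h1
    linarith
  have hφ0 : φ 0 = 0 := by simp [hφ]
  have hz0 : z = 0 := by
    by_contra hne
    have hr : 0 < ‖z‖ := norm_pos_iff.mpr hne
    set e : Euc d := ‖z‖⁻¹ • z with he
    have hen : ‖e‖ = 1 := by simp [he, norm_smul, hr.ne']
    have hze : z = ‖z‖ • e := by simp [he, smul_smul, hr.ne']
    set E : ℝ := Real.exp (-(l * ‖z‖)) with hE
    have hEpos : 0 < E := Real.exp_pos _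
    have hg1 : ‖gradient u (y + z)‖ ≤ B * E := by
      rw [norm_gradient]
      refine norm_fderiv_le_of_directional hv (by positivity) fun ξ τ hτ => ?_
      have h1 := hglob (y + z + τ • ξ) y
      have h2 : ‖y + z + τ • ξ - y‖ ≤ ‖z‖ + τ * ‖ξ‖ := by
        rw [show y + z + τ • ξ - y = z + τ • ξ by abel]
        refine (norm_add_le _ _).trans_eq ?_
        rw [norm_smul, Real.norm_of_nonneg hτ.le]
      linarith [hmono h2, htan ‖z‖ (τ * ‖ξ‖)]
    have hg2 : ‖gradient u y‖ ≤ B * E := by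
      have hneg : ‖fderiv ℝ (fun x => -u x) y‖ ≤ B * E := by
        refine norm_fderiv_le_of_directional hv.neg (by positivity) fun ξ τ hτ => ?_
        have h1 := hglob (y + z) (y + τ • ξ)
        have h2 : ‖y + z - (y + τ • ξ)‖ ≤ ‖z‖ + τ * ‖ξ‖ := by
          rw [show y + z - (y + τ • ξ) = z - τ • ξ by abel]
          refine (norm_sub_le _ _).trans_eq ?_
          rw [norm_smul, Real.norm_of_nonneg hτ.le]
        linarith [hmono h2, htan ‖z‖ (τ * ‖ξ‖)]
      rw [norm_gradient]
      simpa [fderiv_fun_neg] using hneg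
    set N := fderiv ℝ (fderiv ℝ u) (y + z) - fderiv ℝ (fderiv ℝ u) y with hN
    have hN1 : ∀ ξ, N ξ ξ ≤ 0 := by
      intro ξ
      refine second_order_le_of_isLocalMax hv hv (ψ := fun _ => φ ‖z‖) (ψ' := fun _ => 0)
        (fun t => hasDerivAt_const _ _) (hasDerivAt_const _ _) (y + z) y ξ ξ ?_
      refine Eventually.of_forall fun τ => ?_
      have h := hglob (y + z + τ • ξ) (y + τ • ξ)
      rw [show y + z + τ • ξ - (y + τ • ξ) = z by abel] at h
      simpa using h
    have hN2 : N e e ≤ -(4 * l * (B * E)) := by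
      have hd : ∀ τ : ℝ, HasDerivAt (fun τ => ‖z‖ + 2 * τ) 2 τ := fun τ => by
        simpa using ((hasDerivAt_id τ).const_mul (2 : ℝ)).const_add ‖z‖
      have h := second_order_le_of_isLocalMax hv hv (ψ := fun τ => φ (‖z‖ + 2 * τ))
        (ψ' := fun τ => B * Real.exp (-(l * (‖z‖ + 2 * τ))) * 2)
        (c := -(l * (B * Real.exp (-(l * (‖z‖ + 2 * 0))))) * 2 * 2)
        (fun τ => (hφ1 _).comp τ (hd τ)) (((hφ2 _).comp (0 : ℝ) (hd 0)).mul_const 2)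
        (y + z) y e (-e) ?_
      · simp only [mul_zero, add_zero, map_neg, neg_apply, neg_neg] at h
        simp only [hN, sub_apply]
        linarith
      · have hnear : ∀ᶠ τ : ℝ in 𝓝 0, -(‖z‖ / 2) < τ := lt_mem_nhds (by linarith)
        filter_upwards [hnear] with τ hτ
        have h := hglob (y + z + τ • e) (y + τ • -e)
        have h2 : ‖y + z + τ • e - (y + τ • -e)‖ = ‖z‖ + 2 * τ := by
          rw [show y + z + τ • e - (y + τ • -e) = (‖z‖ + 2 * τ) • e by
            rw [add_smul, ← hze, two_mul, add_smul, smul_neg]; abel]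
          rw [norm_smul, hen, mul_one, Real.norm_of_nonneg (by linarith)]
        rw [h2] at h
        simpa using h
    have htr := sum_mul_nonpos_of_posSemidef (hps e hen) N hN1
    have hee : ∑ i, ∑ j, e i * e j *
        N (EuclideanSpace.single j 1) (EuclideanSpace.single i 1) = N e e := by
      have hexp : e = ∑ i, e i • EuclideanSpace.single i (1 : ℝ) := by
        simpa using ((EuclideanSpace.basisFun (Fin d) ℝ).sum_repr e).symm
      conv_rhs => rw [hexp]
      simp only [map_sum, sum_apply, map_smul,
        smul_apply, smul_eq_mul, Finset.mul_sum]
      exact Finset.sum_congr rfl fun i _ => Finset.sum_congr rfl fun j _ => by ring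
    have htr2 : trAH a u (y + z) - trAH a u y ≤ θ * N e e := by
      have h : ∑ i, ∑ j, (a - θ • Matrix.of fun i j => e i * e j) i j *
          N (EuclideanSpace.single j 1) (EuclideanSpace.single i 1)
          = (trAH a u (y + z) - trAH a u y) - θ * N e e := by
        rw [← hee, trAH_eq, trAH_eq, Finset.mul_sum]
        simp only [← Finset.sum_sub_distrib, Finset.mul_sum]
        refine Finset.sum_congr rfl fun i _ => Finset.sum_congr rfl fun j _ => ?_
        simp only [hN, Matrix.sub_apply, Matrix.smul_apply, Matrix.of_apply, smul_eq_mul,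
          sub_apply]
        ring
      linarith
    have hb1 := (abs_le.mp (hbd (y + z))).1
    have hb2 := (abs_le.mp (hbd y)).2
    have hm1 := mul_le_mul_of_nonneg_left hg1 hM
    have hm2 := mul_le_mul_of_nonneg_left hg2 hM
    have hθN := mul_le_mul_of_nonneg_left hN2 hθ.le
    have hθl : θ * l = M + 1 := by rw [hl]; field_simp
    have hBE : K + 1 ≤ B * E := by
      rw [hB, hE, mul_assoc, ← Real.exp_add]
      refine le_mul_of_one_le_right (by linarith) (Real.one_le_exp ?_)
      have := mul_le_mul_of_nonneg_left hz hlpos.le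
      linarith
    have h5 : θ * -(4 * l * (B * E)) = -(4 * (M * (B * E)) + 4 * (B * E)) := by
      linear_combination (-(4 * (B * E))) * hθl
    have h6 : 0 ≤ M * (B * E) := by positivity
    linarith
  obtain ⟨s, rfl⟩ := Torus.proj_surjective s
  obtain ⟨t, rfl⟩ := Torus.proj_surjective t
  have h := hglob s t
  simp only [hz0, add_zero, sub_self, norm_zero, hφ0] at h
  have h2 : φ ‖s - t‖ ≤ B / l :=
    mul_le_of_le_one_right (by positivity) (by linarith [Real.exp_pos (-(l * ‖s - t‖))])
  change u s - u t ≤ B / l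
  linarith

end Periodic

/-- A Bellman Hamiltonian over a compact control set has at most affine growth in `q`. -/
theorem exists_affine_bound {d : ℕ} {Z : Type*} [TopologicalSpace Z] {A : Set Z}
    (hA : IsCompact A) (p : Euc d) {c f : Torus d → Z → Euc d} {L : Torus d → Z → ℝ}
    (hc : Continuous fun z : Torus d × Z => c z.1 z.2)
    (hf : Continuous fun z : Torus d × Z => f z.1 z.2)
    (hL : Continuous fun z : Torus d × Z => L z.1 z.2) :
    ∃ C M : ℝ, 0 ≤ C ∧ 0 ≤ M ∧ ∀ y q,
      |sSup ((fun α => -⟪p, c y α⟫ - ⟪q, f y α⟫ - L y α) '' A)| ≤ C + M * ‖q‖ := by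
  have hK : IsCompact ((Set.univ : Set (Torus d)) ×ˢ A) := isCompact_univ.prod hA
  obtain ⟨C, hC⟩ := hK.exists_bound_of_continuousOn
    (f := fun z => -⟪p, c z.1 z.2⟫ - L z.1 z.2) (by fun_prop)
  obtain ⟨M, hM⟩ := hK.exists_bound_of_continuousOn (f := fun z => f z.1 z.2) hf.continuousOn
  refine ⟨|C|, |M|, abs_nonneg _, abs_nonneg _, fun y q => ?_⟩
  have hb : ∀ s ∈ (fun α => -⟪p, c y α⟫ - ⟪q, f y α⟫ - L y α) '' A, |s| ≤ |C| + |M| * ‖q‖ := by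
    rintro _ ⟨α, hα, rfl⟩
    have h1 := (hC (y, α) ⟨Set.mem_univ _, hα⟩).trans (le_abs_self C)
    have h2 := (hM (y, α) ⟨Set.mem_univ _, hα⟩).trans (le_abs_self M)
    have h3 := abs_real_inner_le_norm q (f y α)
    have h4 := mul_le_mul_of_nonneg_left h2 (norm_nonneg q)
    simp only [Real.norm_eq_abs] at h1
    rw [abs_le] at h1 h3 ⊢
    simp only at h4 ⊢
    constructor <;> linarith [h1.1, h1.2, h3.1, h3.2]
  rcases A.eq_empty_or_nonempty with rfl | ⟨α, hα⟩
  · simp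
    positivity
  · have hmem := Set.mem_image_of_mem (fun α => -⟪p, c y α⟫ - ⟪q, f y α⟫ - L y α) hα
    rw [abs_le]
    exact ⟨(abs_le.mp (hb _ hmem)).1.trans
        (le_csSup ⟨_, fun s hs => (abs_le.mp (hb s hs)).2⟩ hmem),
      csSup_le ⟨_, hmem⟩ fun s hs => (abs_le.mp (hb s hs)).2⟩

section CellProblem

variable {d : ℕ} {a : Matrix (Fin d) (Fin d) ℝ}
  {H : Torus d → Torus d → Euc d → Euc d → ProbT d → ℝ} {x : Torus d} {p : Euc d} {μ : ProbT d}

theorem tlift_const (r : ℝ) : tlift (fun _ : Torus d => r) = fun _ => r := rfl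

theorem trAH_const (r : ℝ) (y : Euc d) : trAH a (fun _ => r) y = 0 := by
  rw [trAH_eq]
  simp

theorem IsSol.abs_mul_le (ha : a.PosSemidef) {C : ℝ} (hC : ∀ y, |H x y p 0 μ| ≤ C)
    {δ : ℝ} (hδ : 0 < δ) {v : Torus d → ℝ} (hv : IsSol a H δ x p μ v) (t : Torus d) :
    |δ * v t| ≤ C := by
  obtain ⟨t, rfl⟩ := Torus.proj_surjective t
  have h0 : ContDiff ℝ 2 (tlift fun _ : Torus d => (0 : ℝ)) := contDiff_const
  have hg : ∀ y, gradient (tlift fun _ : Torus d => (0 : ℝ)) y = 0 := fun y => by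
    simp [tlift_const, gradient]
  rw [abs_le]
  constructor
  · obtain ⟨y, h1, h2, h3⟩ := exists_touching_point ha h0 hv.1
    have he := hv.2 y
    rw [← h2, hg] at he
    rw [tlift_const, trAH_const] at h3
    have h4 := mul_le_mul_of_nonneg_left (h1 t) hδ.le
    simp only [tlift] at h4
    linarith [(abs_le.mp (hC (Torus.proj y))).2]
  · obtain ⟨y, h1, h2, h3⟩ := exists_touching_point ha hv.1 h0
    have he := hv.2 y
    rw [h2, hg] at he
    rw [tlift_const, trAH_const] at h3
    have h4 := mul_le_mul_of_nonneg_left (h1 t) hδ.le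
    simp only [tlift] at h4
    linarith [(abs_le.mp (hC (Torus.proj y))).1]

/-- Comparison of two discounted problems with different discount factors. -/
theorem IsSol.exists_mul_le_mul (ha : a.PosSemidef) {δ δ' : ℝ} {v w : Torus d → ℝ}
    (hv : IsSol a H δ x p μ v) (hw : IsSol a H δ' x p μ w) : ∃ t, δ * v t ≤ δ' * w t := by
  obtain ⟨y, -, h2, h3⟩ := exists_touching_point ha hv.1 hw.1
  refine ⟨Torus.proj y, ?_⟩
  have h4 := hv.2 y
  have h5 := hw.2 y
  rw [h2] at h4
  linarith

theorem exists_isSol_oscillation_bound (ha : a.PosDef) {C M : ℝ} (hC : 0 ≤ C) (hM : 0 ≤ M)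
    (hH : ∀ y q, |H x y p q μ| ≤ C + M * ‖q‖) :
    ∃ D : ℝ, ∀ δ : ℝ, 0 < δ → ∀ v, IsSol a H δ x p μ v → ∀ s t, v s - v t ≤ D := by
  obtain ⟨D, hD⟩ := exists_oscillation_bound ha (K := 2 * C) (by positivity) hM
  refine ⟨D, fun δ hδ v hv => hD v hv.1 fun y => ?_⟩
  have h1 := hv.abs_mul_le ha.posSemidef (C := C) (fun y => by simpa using hH y 0) hδ (Torus.proj y)
  have h2 := hH (Torus.proj y) (gradient (tlift v) y)
  have h3 := hv.2 y
  rw [abs_le] at h1 h2 ⊢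
  constructor <;> linarith [h1.1, h1.2, h2.1, h2.2]

end CellProblem

/-- For every `(x, p, μ)` there is a real number `H̄(x,p,μ)` such that
`δ v^δ → −H̄(x,p,μ)` uniformly on `𝕋^d` as `δ → 0⁺`, along classical solutions `v^δ` of the
discounted cell problem. -/
theorem effective_hamiltonian_limit (d : ℕ)
    -- `a = σ₂σ₂ᵀ + σ_{0,2}σ_{0,2}ᵀ` is a constant symmetric positive definite matrix
    (a : Matrix (Fin d) (Fin d) ℝ) (ha : a.PosDef) (haS : a.IsSymm)
    -- `A ⊂ ℝ^{2d}` is a compact set of controls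
    (A : Set (Euc (2*d))) (hA : IsCompact A)
    -- the data `c, f, L`, continuous and Lipschitz in `(x,y,μ)` uniformly in `α ∈ A`
    (c f : Torus d → Torus d → Euc (2*d) → ProbT d → Euc d)
    (L : Torus d → Torus d → Euc (2*d) → ProbT d → ℝ)
    (hccont : ∀ μ, Continuous fun z : Torus d × Torus d × Euc (2*d) => c z.1 z.2.1 z.2.2 μ)
    (hfcont : ∀ μ, Continuous fun z : Torus d × Torus d × Euc (2*d) => f z.1 z.2.1 z.2.2 μ)
    (hLcont : ∀ μ, Continuous fun z : Torus d × Torus d × Euc (2*d) => L z.1 z.2.1 z.2.2 μ)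
    (K : ℝ)
    (hclip : ∀ x x' y y' α μ μ', α ∈ A →
      ‖c x y α μ - c x' y' α μ'‖ ≤ K * (dist x x' + dist y y' + W1T μ μ'))
    (hflip : ∀ x x' y y' α μ μ', α ∈ A →
      ‖f x y α μ - f x' y' α μ'‖ ≤ K * (dist x x' + dist y y' + W1T μ μ'))
    (hLlip : ∀ x x' y y' α μ μ', α ∈ A →
      |L x y α μ - L x' y' α μ'| ≤ K * (dist x x' + dist y y' + W1T μ μ'))
    -- the Bellman Hamiltonian
    (H : Torus d → Torus d → Euc d → Euc d → ProbT d → ℝ)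
    (hHdef : ∀ x y p q μ,
      H x y p q μ =
        sSup ((fun α => -⟪p, c x y α μ⟫ - ⟪q, f x y α μ⟫ - L x y α μ) '' A))
    (C_H β : ℝ) (hβ0 : 0 < β) (hβ1 : β < 1)
    -- (A3)(2): global Lipschitz-type estimate for `H`
    (hHlip : ∀ x x' y y' p p' q q' μ μ',
      |H x y p q μ - H x' y' p' q' μ'| ≤
        C_H * (1 + ‖p‖ + ‖q‖ + ‖p'‖ + ‖q'‖) *
          (dist x x' + dist y y' + ‖p - p'‖ + ‖q - q'‖ + W1T μ μ'))
    -- (A3)(3): for each `μ`, `(x,y,p,q) ↦ H` is C²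
    (hHC2 : ∀ μ, ContDiff ℝ 2
      (fun z : Euc d × Euc d × Euc d × Euc d =>
        H (Torus.proj z.1) (Torus.proj z.2.1) z.2.2.1 z.2.2.2 μ))
    -- with second derivative locally β-Hölder continuous uniformly in `μ`
    (hHholder : ∀ R : ℝ, 0 < R → ∃ C : ℝ, ∀ μ, ∀ z z' : Euc d × Euc d × Euc d × Euc d,
      ‖z‖ ≤ R → ‖z'‖ ≤ R →
      ‖iteratedFDeriv ℝ 2 (fun w : Euc d × Euc d × Euc d × Euc d =>
          H (Torus.proj w.1) (Torus.proj w.2.1) w.2.2.1 w.2.2.2 μ) z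
        - iteratedFDeriv ℝ 2 (fun w : Euc d × Euc d × Euc d × Euc d =>
          H (Torus.proj w.1) (Torus.proj w.2.1) w.2.2.1 w.2.2.2 μ) z'‖
        ≤ C * ‖z - z'‖ ^ β)
    -- `|D_x H| ≤ C_H (1+|p|)` and `|D_p H| ≤ C_H (1+|p|)`
    (hDx : ∀ (x : Euc d) (y : Torus d) (p q : Euc d) (μ : ProbT d),
      ‖fderiv ℝ (fun x' : Euc d => H (Torus.proj x') y p q μ) x‖ ≤ C_H * (1 + ‖p‖))
    (hDp : ∀ (x y : Torus d) (p q : Euc d) (μ : ProbT d),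
      ‖fderiv ℝ (fun p' : Euc d => H x y p' q μ) p‖ ≤ C_H * (1 + ‖p‖))
    :
    ∀ (x : Torus d) (p : Euc d) (μ : ProbT d), ∃ Hbar : ℝ,
      ∀ ε : ℝ, 0 < ε → ∃ δ₀ : ℝ, 0 < δ₀ ∧
        ∀ δ : ℝ, 0 < δ → δ < δ₀ →
          ∀ v : Torus d → ℝ, IsSol a H δ x p μ v →
            (⨆ y : Torus d, |δ * v y + Hbar|) ≤ ε := by
  intro x p μ
  obtain ⟨C, M, hC, hM, hb⟩ := exists_affine_bound hA p
    (c := fun y α => c x y α μ) (f := fun y α => f x y α μ) (L := fun y α => L x y α μ)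
    ((hccont μ).comp (continuous_const.prodMk continuous_id))
    ((hfcont μ).comp (continuous_const.prodMk continuous_id))
    ((hLcont μ).comp (continuous_const.prodMk continuous_id))
  obtain ⟨D, hD⟩ := exists_isSol_oscillation_bound (H := H) (x := x) (p := p) (μ := μ) ha hC hM
    fun y q => by rw [hHdef]; exact hb y q
  set S : Set ℝ := {s | ∃ δ v t, 0 < δ ∧ IsSol a H δ x p μ v ∧ s = δ * v t - D * δ} with hS
  have hcomp : ∀ δ δ' v w, 0 < δ → 0 < δ' → IsSol a H δ x p μ v → IsSol a H δ' x p μ w →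
      ∀ s t, δ * v s - D * δ ≤ δ' * w t + D * δ' := by
    intro δ δ' v w hδ hδ' hv hw s t
    obtain ⟨r, hr⟩ := hv.exists_mul_le_mul ha.posSemidef hw
    have h1 := mul_le_mul_of_nonneg_left (hD δ hδ v hv s r) hδ.le
    have h2 := mul_le_mul_of_nonneg_left (hD δ' hδ' w hw r t) hδ'.le
    linarith
  refine ⟨-sSup S, fun ε hε => ⟨ε / (|D| + 1), by positivity, fun δ hδ hlt v hv => ?_⟩⟩
  refine ciSup_le fun t => ?_
  have hup : δ * v t - D * δ ≤ sSup S := by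
    refine le_csSup ⟨δ * v t + D * δ, ?_⟩ ⟨δ, v, t, hδ, hv, rfl⟩
    rintro _ ⟨δ', w, r, hδ', hw, rfl⟩
    exact hcomp δ' δ w v hδ' hδ hw hv r t
  have hlo : sSup S ≤ δ * v t + D * δ := by
    refine csSup_le ⟨_, δ, v, t, hδ, hv, rfl⟩ ?_
    rintro _ ⟨δ', w, r, hδ', hw, rfl⟩
    exact hcomp δ' δ w v hδ' hδ hw hv r t
  rw [lt_div_iff₀ (by positivity)] at hlt
  have hDδ := mul_le_mul_of_nonneg_right (le_abs_self D) hδ.le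
  rw [abs_le]
  constructor <;> linarith
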